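/- arXiv:1912.04647 — 3 statements merged into one kernel-verified Lean document; each statement's English description precedes it below -/
import Mathlib

section
/- Let p be an odd prime, m ∈ ℕ, and n ≥ 1 an integer. Let K be the algebraic closure of ℚ_p, let 𝒪 be the integral closure of ℤ_p in K, let ζ ∈ 𝒪 be a primitive n-th root of unity, and let a ∈ ℤ_p satisfy a^{p−1} = 1. Then each root θ ∈ K of θ^p − θ = ζ^l (0 ≤ l ≤ n−1) lies in 𝒪 and 1 − pθ^{p−1} is a unit of 𝒪, and the element n·a^m·b_m(a^{−1}) + Σ_{l=0}^{n−1} ζ^l · Σ_{θ ∈ K, θ^p − θ = ζ^l} (1 − pθ^{p−1})^{−1} · θ^m · Σ_{k=0}^{np−1} Π_{j=1}^{k} (θ + j·a) of K lies in np·𝒪, where b_m(a^{−1}) ∈ ℤ_p denotes the evaluation of the Bell polynomial b_m(x) at a^{−1}. -/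
open Polynomial

/-- Stirling numbers of the second kind. -/
def stirling2 : ℕ → ℕ → ℕ
  | 0, 0 => 1
  | 0, _ + 1 => 0
  | _ + 1, 0 => 0
  | n + 1, j + 1 => (j + 1) * stirling2 n (j + 1) + stirling2 n j

/-- Evaluation of the Bell polynomial `b_n(x) = ∑_j S(n,j) x^j`. -/
def bellEval {R : Type*} [CommRing R] (n : ℕ) (x : R) : R :=
  ∑ j ∈ Finset.range (n + 1), (stirling2 n j : R) * x ^ j

section TopCoeff

variable {R : Type*} [CommRing R]

/-- The coefficient of degree `F.natDegree - 1` of the remainder of `g` modulo `F`. -/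
noncomputable def modTopCoeff (F g : R[X]) : R := (g %ₘ F).coeff (F.natDegree - 1)

theorem modTopCoeff_add (F g h : R[X]) :
    modTopCoeff F (g + h) = modTopCoeff F g + modTopCoeff F h := by
  simp [modTopCoeff, add_modByMonic]

theorem modTopCoeff_C_mul (F g : R[X]) (c : R) :
    modTopCoeff F (C c * g) = c * modTopCoeff F g := by
  simp [modTopCoeff, ← smul_eq_C_mul, smul_modByMonic]

theorem modTopCoeff_sum {ι : Type*} (s : Finset ι) (F : R[X]) (g : ι → R[X]) :
    modTopCoeff F (∑ i ∈ s, g i) = ∑ i ∈ s, modTopCoeff F (g i) := by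
  classical
  induction s using Finset.induction_on with
  | empty => simp [modTopCoeff]
  | insert i s hi ih => rw [Finset.sum_insert hi, Finset.sum_insert hi, modTopCoeff_add, ih]

theorem modTopCoeff_add_self_mul {F : R[X]} (hF : F.Monic) (g h : R[X]) :
    modTopCoeff F (g + F * h) = modTopCoeff F g := by
  simp [modTopCoeff, add_modByMonic, self_mul_modByMonic hF]

theorem modTopCoeff_map {S : Type*} [CommRing S] [Nontrivial S] (f : R →+* S) {F : R[X]}
    (hF : F.Monic) (g : R[X]) : modTopCoeff (F.map f) (g.map f) = f (modTopCoeff F g) := by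
  rw [modTopCoeff, modTopCoeff, ← map_modByMonic f hF, coeff_map, hF.natDegree_map]

theorem coeff_comp_X_add_C_of_natDegree_le {g : R[X]} {d : ℕ} (hg : g.natDegree ≤ d) (c : R) :
    (g.comp (X + C c)).coeff d = g.coeff d := by
  nontriviality R
  have hdeg : (g.comp (X + C c)).natDegree = g.natDegree := natDegree_taylor g c
  rcases hg.lt_or_eq with h | rfl
  · rw [coeff_eq_zero_of_natDegree_lt (hdeg ▸ h), coeff_eq_zero_of_natDegree_lt h]
  · exact coeff_taylor_natDegree c g

theorem modTopCoeff_comp_X_add_C {F : R[X]} (hF : F.Monic) (hpos : 0 < F.natDegree) {c : R}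
    (hc : F.comp (X + C c) = F) (g : R[X]) :
    modTopCoeff F (g.comp (X + C c)) = modTopCoeff F g := by
  nontriviality R
  have hlt : (g %ₘ F).natDegree < F.natDegree :=
    natDegree_modByMonic_lt g hF (fun h => by simp [h] at hpos)
  have hmod : g.comp (X + C c) %ₘ F = (g %ₘ F).comp (X + C c) := by
    refine (div_modByMonic_unique ((g /ₘ F).comp (X + C c)) _ hF ⟨?_, ?_⟩).2
    · conv_rhs => rw [← modByMonic_add_div g F]
      rw [add_comp, mul_comp, hc]
    · refine degree_lt_degree ?_
      rwa [show ((g %ₘ F).comp (X + C c)).natDegree = (g %ₘ F).natDegree from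
        natDegree_taylor _ c]
  rw [modTopCoeff, modTopCoeff, hmod]
  exact coeff_comp_X_add_C_of_natDegree_le (by omega) c

/-- Euler's formula for the sum of `g(θ) / F'(θ)` over the roots `θ` of `F`. -/
theorem modTopCoeff_nodal {k : Type*} [Field k] [DecidableEq k] (s : Finset k) (g : k[X]) :
    modTopCoeff (Lagrange.nodal s id) g =
      ∑ θ ∈ s, g.eval θ / (derivative (Lagrange.nodal s id)).eval θ := by
  have hm : (Lagrange.nodal s (id : k → k)).Monic := Lagrange.nodal_monic
  have hdeg := degree_modByMonic_lt g hm
  rw [Lagrange.degree_nodal] at hdeg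
  rw [modTopCoeff, Lagrange.natDegree_nodal,
    Lagrange.coeff_eq_sum (v := id) (Function.injective_id.injOn) hdeg]
  refine Finset.sum_congr rfl fun θ hθ => ?_
  have h0 := Lagrange.eval_nodal_at_node (v := (id : k → k)) hθ
  have h1 := Lagrange.eval_nodal_derivative_eval_node_eq (v := (id : k → k)) hθ
  rw [Lagrange.eval_nodal] at h1
  simp only [id_eq] at h0 h1 ⊢
  rw [h1]
  congr 1
  conv_rhs => rw [← modByMonic_add_div g (Lagrange.nodal s id)]
  simp [h0]

end TopCoeff

section Bell

variable {R : Type*} [CommRing R]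

theorem stirling2_eq_zero_of_lt : ∀ {m j : ℕ}, m < j → stirling2 m j = 0
  | 0, _ + 1, _ => rfl
  | m + 1, j + 1, h => by
    rw [stirling2, stirling2_eq_zero_of_lt (by omega : m < j + 1),
      stirling2_eq_zero_of_lt (by omega : m < j), mul_zero]

theorem map_bellEval {S : Type*} [CommRing S] (f : R →+* S) (m : ℕ) (x : R) :
    f (bellEval m x) = bellEval m (f x) := by
  simp [bellEval, map_sum]

/-- The falling factorial `X (X - a) ⋯ (X - (j - 1) a)`. -/
noncomputable def fallingProd (a : R) (j : ℕ) : R[X] := ∏ i ∈ Finset.range j, (X - C ((i : R) * a))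

theorem fallingProd_succ (a : R) (j : ℕ) :
    fallingProd a (j + 1) = fallingProd a j * (X - C ((j : R) * a)) :=
  Finset.prod_range_succ _ _

theorem fallingProd_succ_comp (a : R) (j : ℕ) :
    (fallingProd a (j + 1)).comp (X + C a) = (X + C a) * fallingProd a j := by
  rw [fallingProd, prod_comp, Finset.prod_range_succ', mul_comm, fallingProd]
  congr 1
  · simp
  · refine Finset.prod_congr rfl fun i _ => ?_
    simp only [sub_comp, X_comp, C_comp]
    push_cast
    simp only [C_add, C_mul, map_natCast, C_1]
    ring

theorem X_pow_eq_sum_stirling2 {a b : R} (hab : a * b = 1) (m : ℕ) :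
    (X : R[X]) ^ m = ∑ j ∈ Finset.range (m + 1),
      C (a ^ m * ((stirling2 m j : R) * b ^ j)) * fallingProd a j := by
  induction m with
  | zero => simp [stirling2, fallingProd]
  | succ m ih =>
    have hab' : (C a : R[X]) * C b = 1 := by rw [← C_mul, hab, C_1]
    have hstep (j : ℕ) : (X : R[X]) * (C (a ^ m * ((stirling2 m j : R) * b ^ j)) *
        fallingProd a j) =
        C (a ^ (m + 1) * ((stirling2 m j : R) * b ^ (j + 1))) * fallingProd a (j + 1) +
        C (a ^ (m + 1) * (((j * stirling2 m j : ℕ) : R) * b ^ j)) * fallingProd a j := by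
      rw [fallingProd_succ]
      simp only [C_mul, C_pow, map_natCast, Nat.cast_mul]
      linear_combination (-(C a ^ m * (stirling2 m j : R[X]) * C b ^ j * fallingProd a j *
        (X - (j : R[X]) * C a))) * hab'
    rw [pow_succ', ih, Finset.mul_sum, Finset.sum_congr rfl fun j _ => hstep j,
      Finset.sum_add_distrib, Finset.sum_range_succ' _ (m + 1)]
    have hsecond : ∑ j ∈ Finset.range (m + 1),
        C (a ^ (m + 1) * (((j * stirling2 m j : ℕ) : R) * b ^ j)) * fallingProd a j =
        ∑ j ∈ Finset.range (m + 1),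
        C (a ^ (m + 1) * ((((j + 1) * stirling2 m (j + 1) : ℕ) : R) * b ^ (j + 1))) *
          fallingProd a (j + 1) := by
      rw [Finset.sum_range_succ', Finset.sum_range_succ _ m]
      simp [stirling2_eq_zero_of_lt (Nat.lt_succ_self m)]
    rw [hsecond, ← Finset.sum_add_distrib]
    simp only [stirling2, Nat.cast_zero, zero_mul, mul_zero, C_0, add_zero]
    refine Finset.sum_congr rfl fun j _ => ?_
    rw [← add_mul, ← C_add]
    congr 2
    push_cast
    ring

/-- The polynomial `∑_{k < N} ∏_{j = 1}^k (X + j a)`. -/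
noncomputable def risingSum (a : R) (N : ℕ) : R[X] :=
  ∑ k ∈ Finset.range N, ∏ j ∈ Finset.Icc 1 k, (X + C ((j : R) * a))

theorem prod_Icc_one_eq_prod_range {M : Type*} [CommMonoid M] (f : ℕ → M) (k : ℕ) :
    ∏ j ∈ Finset.Icc 1 k, f j = ∏ j ∈ Finset.range k, f (j + 1) := by
  rw [Finset.range_eq_Ico, Finset.prod_Ico_add' f 0 k 1]
  rfl

theorem risingSum_comp (a : R) (N : ℕ) :
    (X + C a) * (risingSum a N).comp (X + C a) =
      risingSum a N + ((∏ j ∈ Finset.range N, (X + C (((j + 1 : ℕ) : R) * a))) - 1) := by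
  induction N with
  | zero => simp [risingSum]
  | succ N ih =>
    have hprod : (X + C a) * (∏ j ∈ Finset.range N, (X + C (((j + 1 : ℕ) : R) * a))).comp
        (X + C a) = ∏ j ∈ Finset.range (N + 1), (X + C (((j + 1 : ℕ) : R) * a)) := by
      rw [prod_comp, Finset.prod_range_succ', mul_comm]
      congr 1
      · refine Finset.prod_congr rfl fun i _ => ?_
        simp only [add_comp, X_comp, C_comp]
        push_cast
        simp only [C_add, C_mul, map_natCast, C_1]
        ring
      · simp
    rw [risingSum, Finset.sum_range_succ, ← risingSum, add_comp, mul_add, ih,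
      prod_Icc_one_eq_prod_range, hprod]
    ring

theorem risingSum_map {S : Type*} [CommRing S] (f : R →+* S) (a : R) (N : ℕ) :
    (risingSum a N).map f = risingSum (f a) N := by
  simp [risingSum, Polynomial.map_sum, Polynomial.map_prod]

theorem eval_risingSum (a x : R) (N : ℕ) :
    (risingSum a N).eval x =
      ∑ k ∈ Finset.range N, ∏ j ∈ Finset.Icc 1 k, (x + (j : R) * a) := by
  simp [risingSum, eval_finsetSum, eval_prod]

theorem isMonicOfDegree_risingSum_succ [Nontrivial R] (a : R) (N : ℕ) :
    IsMonicOfDegree (risingSum a (N + 1)) N := by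
  have hprod (k : ℕ) : IsMonicOfDegree (∏ j ∈ Finset.Icc 1 k, (X + C ((j : R) * a))) k := by
    refine ⟨?_, monic_prod_of_monic _ _ fun j _ => monic_X_add_C _⟩
    rw [natDegree_prod_of_monic _ _ fun j _ => monic_X_add_C _]
    simp only [natDegree_X_add_C, Finset.sum_const, Nat.card_Icc, smul_eq_mul, mul_one,
      Nat.add_sub_cancel]
  rw [risingSum, Finset.sum_range_succ, add_comm]
  rcases N.eq_zero_or_pos with rfl | hN
  · simp
  · refine (hprod N).add_right ?_
    refine lt_of_le_of_lt (natDegree_sum_le_of_forall_le (n := N - 1) _ _ fun k hk => ?_)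
      (by omega)
    rw [(hprod k).natDegree_eq]
    have := Finset.mem_range.mp hk
    omega

/-- The polynomial `(X ^ p - X) ^ n - 1`. -/
noncomputable def artinSchreierPow (R : Type*) [CommRing R] (p n : ℕ) : R[X] := (X ^ p - X) ^ n - 1

theorem artinSchreierPow_map {S : Type*} [CommRing S] (f : R →+* S) (p n : ℕ) :
    (artinSchreierPow R p n).map f = artinSchreierPow S p n := by
  simp [artinSchreierPow]

theorem isMonicOfDegree_artinSchreierPow [Nontrivial R] {p n : ℕ} (hp : 1 < p) (hn : 0 < n) :
    IsMonicOfDegree (artinSchreierPow R p n) (n * p) := by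
  have h1 : IsMonicOfDegree (X ^ p - X : R[X]) p :=
    (isMonicOfDegree_X_pow R p).sub (by simpa using hp)
  rw [mul_comm]
  exact (h1.pow n).sub (by simpa using Nat.mul_pos (by omega) hn)

end Bell

section ModP

variable {p : ℕ} [Fact p.Prime]

theorem prod_range_X_add_C_mul {a : ZMod p} (ha : a ≠ 0) :
    ∏ j ∈ Finset.range p, (X + C (((j + 1 : ℕ) : ZMod p) * a)) = (X ^ p - X : (ZMod p)[X]) := by
  have hp := (Fact.out : p.Prime).one_lt
  have hinj : Function.Injective fun x : ZMod p => -((x + 1) * a) := fun x y h => by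
    simpa [ha] using h
  have hmonic : (X ^ p - X : (ZMod p)[X]).Monic :=
    ((isMonicOfDegree_X_pow _ p).sub (by simpa using hp)).monic
  have hroots : (X ^ p - X : (ZMod p)[X]).roots = Finset.univ.val := by
    simpa [ZMod.card] using FiniteField.roots_X_pow_card_sub_X (ZMod p)
  have hsplits : (X ^ p - X : (ZMod p)[X]).Splits := by
    rw [splits_iff_card_roots, hroots, FiniteField.X_pow_card_sub_X_natDegree_eq _ hp]
    exact ZMod.card p
  calc ∏ j ∈ Finset.range p, (X + C (((j + 1 : ℕ) : ZMod p) * a))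
      = ∏ x : ZMod p, (X - C (-((x + 1) * a))) := by
        refine Finset.prod_nbij' (fun j => (j : ZMod p)) ZMod.val (by simp)
          (fun x _ => Finset.mem_range.mpr (ZMod.val_lt x))
          (fun j hj => ZMod.val_cast_of_lt (Finset.mem_range.mp hj)) (by simp) fun j _ => ?_
        simp
    _ = ∏ x : ZMod p, (X - C x) :=
        (Finite.injective_iff_bijective.mp hinj).prod_comp fun x => X - C x
    _ = X ^ p - X := by
        conv_rhs => rw [hsplits.eq_prod_roots_of_monic hmonic, hroots]
        rfl

theorem prod_range_mul_X_add_C_mul {a : ZMod p} (ha : a ≠ 0) (n : ℕ) :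
    ∏ j ∈ Finset.range (n * p), (X + C (((j + 1 : ℕ) : ZMod p) * a)) =
      ((X ^ p - X) ^ n : (ZMod p)[X]) := by
  induction n with
  | zero => simp
  | succ n ih =>
    rw [add_mul, one_mul, Finset.prod_range_add, ih, pow_succ, ← prod_range_X_add_C_mul ha]
    congr 1
    refine Finset.prod_congr rfl fun j _ => ?_
    push_cast
    simp

theorem artinSchreierPow_comp (a : ZMod p) (n : ℕ) :
    (artinSchreierPow (ZMod p) p n).comp (X + C a) = artinSchreierPow (ZMod p) p n := by
  simp [artinSchreierPow, add_pow_char, ← C_pow, ZMod.pow_card]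

theorem modTopCoeff_fallingProd_mul_risingSum {a : ZMod p} (ha : a ≠ 0) {n : ℕ} (hn : 0 < n)
    (j : ℕ) :
    modTopCoeff (artinSchreierPow (ZMod p) p n) (fallingProd a j * risingSum a (n * p)) = 1 := by
  have hp := (Fact.out : p.Prime).one_lt
  have hF := isMonicOfDegree_artinSchreierPow (R := ZMod p) hp hn
  have hpos : 0 < n * p := Nat.mul_pos hn (by omega)
  induction j with
  | zero =>
    obtain ⟨N, hN⟩ : ∃ N, n * p = N + 1 := ⟨n * p - 1, by omega⟩
    have hG := isMonicOfDegree_risingSum_succ a N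
    rw [← hN] at hG
    rw [fallingProd, Finset.prod_range_zero, one_mul, modTopCoeff,
      (modByMonic_eq_self_iff hF.monic).mpr
        (degree_lt_degree (by rw [hG.natDegree_eq, hF.natDegree_eq]; omega)),
      hF.natDegree_eq, hN, Nat.add_sub_cancel]
    rw [← hN, ← hG.monic.coeff_natDegree, hG.natDegree_eq]
  | succ j ih =>
    rw [← modTopCoeff_comp_X_add_C hF.monic (by rw [hF.natDegree_eq]; exact hpos)
      (artinSchreierPow_comp a n), mul_comp, fallingProd_succ_comp, mul_right_comm,
      risingSum_comp, prod_range_mul_X_add_C_mul ha, mul_comm, mul_add, ← artinSchreierPow, mul_comm _ (artinSchreierPow _ _ _),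
      modTopCoeff_add_self_mul hF.monic, ih]

theorem modTopCoeff_X_pow_mul_risingSum {a b : ZMod p} (hab : a * b = 1) {n : ℕ} (hn : 0 < n)
    (m : ℕ) :
    modTopCoeff (artinSchreierPow (ZMod p) p n) (X ^ m * risingSum a (n * p)) =
      a ^ m * bellEval m b := by
  have ha : a ≠ 0 := left_ne_zero_of_mul_eq_one hab
  rw [X_pow_eq_sum_stirling2 hab, Finset.sum_mul, modTopCoeff_sum, bellEval, Finset.mul_sum]
  refine Finset.sum_congr rfl fun j _ => ?_
  rw [mul_assoc, modTopCoeff_C_mul, modTopCoeff_fallingProd_mul_risingSum ha hn, mul_one]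

theorem exists_bellEval_sub_modTopCoeff_eq {a b : ℤ_[p]} (hab : a * b = 1) {n : ℕ}
    (hn : 0 < n) (m : ℕ) :
    ∃ c : ℤ_[p], a ^ m * bellEval m b -
      modTopCoeff (artinSchreierPow ℤ_[p] p n) (X ^ m * risingSum a (n * p)) = p * c := by
  have hF := isMonicOfDegree_artinSchreierPow (R := ℤ_[p]) (Fact.out : p.Prime).one_lt hn
  rw [← dvd_def, ← Ideal.mem_span_singleton, ← PadicInt.maximalIdeal_eq_span_p,
    ← PadicInt.ker_toZMod, RingHom.mem_ker, map_sub, map_mul, map_pow, map_bellEval,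
    ← modTopCoeff_map _ hF.monic, artinSchreierPow_map, Polynomial.map_mul, Polynomial.map_pow,
    map_X, risingSum_map,
    modTopCoeff_X_pow_mul_risingSum (b := PadicInt.toZMod b) (by rw [← map_mul, hab, map_one]) hn,
    sub_self]

end ModP

section Units

theorem isUnit_one_sub_mul_of_mem_maximalIdeal {A B : Type*} [CommRing A] [IsLocalRing A]
    [CommRing B] [Algebra A B] [Algebra.IsIntegral A B] {t : A}
    (ht : t ∈ IsLocalRing.maximalIdeal A) (y : B) : IsUnit (1 - algebraMap A B t * y) := by
  by_contra h
  obtain ⟨M, hM, hmem⟩ := exists_max_ideal_of_mem_nonunits h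
  have hcomap := Ideal.isMaximal_comap_of_isIntegral_of_isMaximal (R := A) M
  rw [← IsLocalRing.eq_maximalIdeal hcomap, Ideal.mem_comap] at ht
  exact hM.ne_top ((Ideal.eq_top_iff_one M).mpr
    (by simpa using M.add_mem hmem (M.mul_mem_right y ht)))

end Units

section Roots

variable {K : Type*} [Field K] [DecidableEq K]

theorem prod_toFinset_roots_of_derivative_ne_zero [IsAlgClosed K] {f : K[X]} (hf : f.Monic)
    (h : ∀ θ, f.IsRoot θ → (derivative f).eval θ ≠ 0) :
    ∏ θ ∈ f.roots.toFinset, (X - C θ) = f := by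
  have hnodup : f.roots.Nodup := by
    refine Multiset.nodup_iff_count_le_one.mpr fun θ => ?_
    by_contra! hlt
    rw [count_roots] at hlt
    obtain ⟨h1, h2⟩ := (one_lt_rootMultiplicity_iff_isRoot hf.ne_zero).mp hlt
    exact h θ h1 h2
  rw [Finset.prod, Multiset.toFinset_val, hnodup.dedup]
  exact ((IsAlgClosed.splits f).eq_prod_roots_of_monic hf).symm

theorem sum_roots_eq_neg_mul_modTopCoeff [IsAlgClosed K] [CharZero K] {p n : ℕ} (hp : 1 < p) (hn : 0 < n)
    {ζ : K} (hζ : IsPrimitiveRoot ζ n)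
    (hunit : ∀ l < n, ∀ θ : K, θ ^ p - θ = ζ ^ l → 1 - (p : K) * θ ^ (p - 1) ≠ 0) (g : K[X]) :
    ∑ l ∈ Finset.range n, ζ ^ l * ∑ θ ∈ (X ^ p - X - C (ζ ^ l) : K[X]).roots.toFinset,
        (1 - (p : K) * θ ^ (p - 1))⁻¹ * g.eval θ =
      -(n * modTopCoeff (artinSchreierPow K p n) g) := by
  have hmonic (c : K) : (X ^ p - X - C c : K[X]).Monic :=
    (((isMonicOfDegree_X_pow K p).sub (by simpa using hp)).sub (by simp; omega)).monic
  have hmem (c θ : K) : θ ∈ (X ^ p - X - C c : K[X]).roots.toFinset ↔ θ ^ p - θ = c := by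
    rw [Multiset.mem_toFinset, mem_roots (hmonic c).ne_zero]
    simp [sub_eq_zero]
  have hdisj : Set.PairwiseDisjoint (Finset.range n : Set ℕ)
      fun l => (X ^ p - X - C (ζ ^ l) : K[X]).roots.toFinset := by
    intro i hi j hj hij
    refine Finset.disjoint_left.mpr fun θ h1 h2 => hij ?_
    rw [hmem] at h1 h2
    exact hζ.pow_inj (by simpa using hi) (by simpa using hj) (h1.symm.trans h2)
  set S := (Finset.range n).biUnion
    fun l => (X ^ p - X - C (ζ ^ l) : K[X]).roots.toFinset with hS
  have hnodal : Lagrange.nodal S id = artinSchreierPow K p n := by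
    rw [Lagrange.nodal, hS, Finset.prod_biUnion hdisj]
    have h := congrArg (fun q : K[X] => q.comp (X ^ p - X))
      (X_pow_sub_C_eq_prod hζ hn (one_pow n))
    simp only [sub_comp, pow_comp, X_comp, prod_comp, C_comp, mul_one, C_1, one_comp] at h
    rw [artinSchreierPow, h]
    refine Finset.prod_congr rfl fun l hl => ?_
    refine prod_toFinset_roots_of_derivative_ne_zero (hmonic _) fun θ hθ h0 => ?_
    refine hunit l (Finset.mem_range.mp hl) θ ?_ ?_
    · simpa [sub_eq_zero] using hθ
    · simp only [derivative_sub, derivative_X_pow, derivative_X, derivative_C, eval_sub, eval_mul,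
        eval_C, eval_pow, eval_X, eval_one, eval_zero] at h0
      linear_combination -h0
  rw [← hnodal, modTopCoeff_nodal, hnodal, hS, Finset.sum_biUnion hdisj, Finset.mul_sum,
    ← Finset.sum_neg_distrib]
  refine Finset.sum_congr rfl fun l hl => ?_
  rw [Finset.mul_sum, Finset.mul_sum, ← Finset.sum_neg_distrib]
  refine Finset.sum_congr rfl fun θ hθ => ?_
  rw [hmem] at hθ
  have hu := hunit l (Finset.mem_range.mp hl) θ hθ
  have hn0 : (n : K) ≠ 0 := Nat.cast_ne_zero.mpr hn.ne'
  have hder : (derivative (artinSchreierPow K p n)).eval θ * ζ ^ l =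
      -(n * (1 - (p : K) * θ ^ (p - 1))) := by
    have hpow : (ζ ^ l) ^ (n - 1) * ζ ^ l = 1 := by
      rw [← pow_succ, Nat.sub_add_cancel hn, ← pow_mul, mul_comm, pow_mul, hζ.pow_eq_one,
        one_pow]
    simp [artinSchreierPow, derivative_pow, hθ]
    linear_combination (n * ((p : K) * θ ^ (p - 1) - 1)) * hpow
  have hζ0 : ζ ^ l ≠ 0 := pow_ne_zero _ (hζ.ne_zero hn.ne')
  have hder' : (derivative (artinSchreierPow K p n)).eval θ =
      -(n * (1 - (p : K) * θ ^ (p - 1))) / ζ ^ l := by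
    rw [← hder, mul_div_cancel_right₀ _ hζ0]
  rw [hder']
  field_simp

end Roots

/-- Junod's intermediate congruence (corrected): with `K = algebraic closure of ℚ_p`,
`𝒪` the integral closure of `ℤ_p` in `K`, `ζ ∈ 𝒪` a primitive `n`-th root of unity and
`a ∈ ℤ_p` with `a^{p-1} = 1`: every root `θ` of `θ^p - θ = ζ^l` lies in `𝒪` with
`1 - pθ^{p-1}` a unit of `𝒪`, and
`n a^m b_m(a⁻¹) + ∑_{l=0}^{n-1} ζ^l ∑_{θ^p-θ=ζ^l} (1-pθ^{p-1})⁻¹ θ^m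
   ∑_{k=0}^{np-1} ∏_{j=1}^k (θ + ja)` lies in `np·𝒪`. -/
theorem junod_intermediate_congruence (p : ℕ) [Fact p.Prime] (hodd : Odd p)
    (m n : ℕ) (hn : 1 ≤ n)
    (ζ : AlgebraicClosure ℚ_[p]) (hζO : ζ ∈ integralClosure ℤ_[p] (AlgebraicClosure ℚ_[p]))
    (hζ : IsPrimitiveRoot ζ n)
    (a : ℤ_[p]) (ha : a ^ (p - 1) = 1) :
    letI : DecidableEq (AlgebraicClosure ℚ_[p]) := Classical.decEq _
    (∀ l < n, ∀ θ ∈ ((X ^ p - X - C (ζ ^ l) :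
          Polynomial (AlgebraicClosure ℚ_[p])).roots).toFinset,
        θ ∈ integralClosure ℤ_[p] (AlgebraicClosure ℚ_[p]) ∧
          ∃ y ∈ integralClosure ℤ_[p] (AlgebraicClosure ℚ_[p]),
            (1 - (p : AlgebraicClosure ℚ_[p]) * θ ^ (p - 1)) * y = 1) ∧
      ∃ c ∈ integralClosure ℤ_[p] (AlgebraicClosure ℚ_[p]),
        (n : AlgebraicClosure ℚ_[p]) *
              (algebraMap ℤ_[p] (AlgebraicClosure ℚ_[p]) a) ^ m *
              bellEval m ((algebraMap ℤ_[p] (AlgebraicClosure ℚ_[p]) a)⁻¹) +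
            ∑ l ∈ Finset.range n, ζ ^ l *
              ∑ θ ∈ ((X ^ p - X - C (ζ ^ l) :
                  Polynomial (AlgebraicClosure ℚ_[p])).roots).toFinset,
                (1 - (p : AlgebraicClosure ℚ_[p]) * θ ^ (p - 1))⁻¹ * θ ^ m *
                  ∑ k ∈ Finset.range (n * p), ∏ j ∈ Finset.Icc 1 k,
                    (θ + (j : AlgebraicClosure ℚ_[p]) *
                      algebraMap ℤ_[p] (AlgebraicClosure ℚ_[p]) a) =
          ((n * p : ℕ) : AlgebraicClosure ℚ_[p]) * c := by
  let _ : DecidableEq (AlgebraicClosure ℚ_[p]) := Classical.decEq _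
  have hp := (Fact.out : p.Prime).one_lt
  have hunit : ∀ l : ℕ, ∀ θ : AlgebraicClosure ℚ_[p], θ ^ p - θ = ζ ^ l →
      θ ∈ integralClosure ℤ_[p] (AlgebraicClosure ℚ_[p]) ∧
        ∃ y ∈ integralClosure ℤ_[p] (AlgebraicClosure ℚ_[p]),
          (1 - (p : AlgebraicClosure ℚ_[p]) * θ ^ (p - 1)) * y = 1 := by
    intro l θ hθ
    have hθO : θ ∈ integralClosure ℤ_[p] (AlgebraicClosure ℚ_[p]) := by
      have hmonic : (X ^ p - X - C (⟨ζ, hζO⟩ ^ l) :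
          (integralClosure ℤ_[p] (AlgebraicClosure ℚ_[p]))[X]).Monic :=
        (((isMonicOfDegree_X_pow _ p).sub (by simpa using hp)).sub
          (by rw [natDegree_C]; omega)).monic
      have hint : IsIntegral (integralClosure ℤ_[p] (AlgebraicClosure ℚ_[p])) θ := by
        refine ⟨_, hmonic, ?_⟩
        rw [eval₂_sub, eval₂_sub, eval₂_X_pow, eval₂_X, eval₂_C, hθ, map_pow]
        exact sub_self _
      exact isIntegral_trans (R := ℤ_[p]) θ hint
    refine ⟨hθO, ?_⟩
    obtain ⟨y, hy⟩ := (isUnit_one_sub_mul_of_mem_maximalIdeal (A := ℤ_[p])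
      (B := integralClosure ℤ_[p] (AlgebraicClosure ℚ_[p])) (t := p)
      (by rw [PadicInt.maximalIdeal_eq_span_p]; exact Ideal.mem_span_singleton_self _)
      (⟨θ, hθO⟩ ^ (p - 1))).exists_right_inv
    refine ⟨y, y.2, ?_⟩
    simpa using congrArg Subtype.val hy
  refine ⟨fun l _ θ hθ => hunit l θ ?_, ?_⟩
  · have := isRoot_of_mem_roots (Multiset.mem_toFinset.mp hθ)
    simpa [sub_eq_zero] using this
  set φ := algebraMap ℤ_[p] (AlgebraicClosure ℚ_[p])
  have hab : a * a ^ (p - 2) = 1 := by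
    rw [← pow_succ', show p - 2 + 1 = p - 1 by omega, ha]
  have hinv : (φ a)⁻¹ = φ (a ^ (p - 2)) := by
    refine inv_eq_of_mul_eq_one_right ?_
    rw [← map_mul, hab, map_one]
  obtain ⟨c, hc⟩ := exists_bellEval_sub_modTopCoeff_eq hab hn m
  refine ⟨φ c, algebraMap_mem _ c, ?_⟩
  have hsum := sum_roots_eq_neg_mul_modTopCoeff hp hn hζ
    (fun l _ θ hθ => by
      obtain ⟨-, y, -, hy⟩ := hunit l θ hθ
      exact left_ne_zero_of_mul_eq_one hy) (X ^ m * risingSum (φ a) (n * p))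
  simp only [eval_mul, eval_pow, eval_X, eval_risingSum, ← mul_assoc] at hsum
  have hF := isMonicOfDegree_artinSchreierPow (R := ℤ_[p]) hp hn
  have hmap := modTopCoeff_map φ hF.monic (X ^ m * risingSum a (n * p))
  rw [artinSchreierPow_map, Polynomial.map_mul, Polynomial.map_pow, map_X, risingSum_map] at hmap
  rw [hmap] at hsum
  have hc' := congrArg φ hc
  rw [map_sub, map_mul, map_pow, map_bellEval, map_mul, map_natCast] at hc'
  rw [hsum, hinv]
  push_cast
  linear_combination (n : AlgebraicClosure ℚ_[p]) * hc'
end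

section
/- Let p be a prime and a ≥ 1 an integer with gcd(a, p) = 1. Then τ_p(a) · (p^a − 1) ≡ 1 (mod k_p), where τ_p(a) := Σ_{j=1}^{p−1} j·p^{ja−1} and k_p := (p^p − 1)/(p − 1). -/
/-- `τ_p(a) = ∑_{j=1}^{p-1} j p^{ja-1}`. -/
def tauP (p a : ℕ) : ℕ := ∑ j ∈ Finset.Icc 1 (p - 1), j * p ^ (j * a - 1)

theorem sum_range_mul_pow_mul_sub_one {R : Type*} [CommRing R] (x : R) (n : ℕ) :
    (∑ j ∈ Finset.range n, (j : R) * x ^ j) * (x - 1) =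
      n * x ^ n - x * ∑ j ∈ Finset.range n, x ^ j := by
  induction n with
  | zero => simp
  | succ n ih =>
    rw [Finset.sum_range_succ, Finset.sum_range_succ, add_mul, ih]
    push_cast
    ring

/-- If `a` and `n` are coprime, the repunit of length `n` in base `b` divides the one
in base `b ^ a`. -/
theorem geom_sum_dvd_geom_sum_pow_of_coprime {b a n : ℕ} (hb : 2 ≤ b)
    (han : Nat.Coprime a n) :
    ∑ i ∈ Finset.range n, b ^ i ∣ ∑ i ∈ Finset.range n, (b ^ a) ^ i := by
  have hb1 : 1 ≤ b := by lia
  have hpos : 0 < b - 1 := by lia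
  have hn := geom_sum_mul_of_one_le hb1 n
  have ha := geom_sum_mul_of_one_le hb1 a
  have hS := geom_sum_mul_of_one_le (Nat.one_le_pow a b hb1) n
  have hcop : Nat.Coprime (∑ i ∈ Finset.range n, b ^ i) (∑ i ∈ Finset.range a, b ^ i) := by
    have h := Nat.pow_sub_one_gcd_pow_sub_one b n a
    rw [← hn, ← ha, Nat.gcd_mul_right, Nat.gcd_comm n a, han, pow_one] at h
    exact Nat.eq_of_mul_eq_mul_right hpos (h.trans (one_mul _).symm)
  refine hcop.dvd_of_dvd_mul_right (Nat.dvd_of_mul_dvd_mul_right hpos ?_)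
  rw [mul_assoc, ha, hS, hn, ← pow_mul, mul_comm a n]
  exact Nat.pow_sub_one_dvd_pow_sub_one b (Dvd.intro a rfl)

theorem mul_tauP {p a : ℕ} (hp : 1 ≤ p) (ha : 1 ≤ a) :
    p * tauP p a = ∑ j ∈ Finset.range p, j * (p ^ a) ^ j := by
  obtain ⟨q, rfl⟩ := Nat.exists_eq_add_of_le' hp
  rw [tauP, Finset.mul_sum, Finset.range_eq_Ico, Finset.sum_eq_sum_Ico_succ_bot (by lia),
    zero_mul, zero_add]
  refine Finset.sum_congr (by ext; simp) fun j hj => ?_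
  have hj1 : 1 ≤ j * a := Nat.mul_pos (Finset.mem_Ico.mp hj).1 ha
  rw [mul_left_comm, ← pow_mul, mul_comm a j, ← pow_succ', Nat.sub_add_cancel hj1]

/-- `τ_p(a)(p^a - 1) ≡ 1 (mod k_p)` where `k_p = (p^p - 1)/(p - 1)`. -/
theorem tauP_mul_pow_sub_one_modEq (p : ℕ) (hp : p.Prime) (a : ℕ) (ha : 1 ≤ a)
    (hap : Nat.gcd a p = 1) :
    tauP p a * (p ^ a - 1) ≡ 1 [MOD (p ^ p - 1) / (p - 1)] := by
  rw [← Nat.geomSum_eq hp.two_le]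
  set k := ∑ i ∈ Finset.range p, p ^ i with hk
  have hk_mul : k * (p - 1) = p ^ p - 1 := geom_sum_mul_of_one_le hp.one_le p
  have hdvd : k ∣ p ^ p - 1 := Dvd.intro _ hk_mul
  have hcop : Nat.Coprime k p := by
    have h : Nat.Coprime (p ^ p - 1) (p ^ p) :=
      (Nat.coprime_self_sub_left (Nat.one_le_pow p p hp.pos)).2 (Nat.coprime_one_left _)
    exact (h.coprime_dvd_left hdvd).coprime_dvd_right (dvd_pow_self p hp.ne_zero)
  have hpow : ((p ^ p : ℕ) : ZMod k) = 1 := by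
    have h := (Nat.modEq_iff_dvd' (Nat.one_le_pow p p hp.pos)).2 hdvd
    simpa using ((ZMod.natCast_eq_natCast_iff _ _ _).2 h).symm
  have hS := (ZMod.natCast_eq_zero_iff _ _).2
    (geom_sum_dvd_geom_sum_pow_of_coprime hp.two_le hap)
  have hsum := sum_range_mul_pow_mul_sub_one ((p : ZMod k) ^ a) p
  have hτ := congrArg (Nat.cast : ℕ → ZMod k) (mul_tauP hp.one_le ha)
  push_cast at hpow hS hτ
  rw [← hτ, hS, pow_right_comm, hpow, one_pow, mul_zero, sub_zero] at hsum
  have hunit : IsUnit (p : ZMod k) := (ZMod.isUnit_iff_coprime p k).2 hcop.symm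
  rw [← ZMod.natCast_eq_natCast_iff]
  push_cast [Nat.cast_sub (Nat.one_le_pow a p hp.pos)]
  exact hunit.mul_left_cancel (by rw [← mul_assoc, hsum])
end

section
/- Let p be an odd prime and m ∈ ℕ, and for k ∈ ℕ let 𝔹_p^{(k)}(x) be the p×p matrix over (ℤ/pℤ)[x] whose (i,j) entry (0 ≤ i, j ≤ p−1) is the Bell polynomial b_{k+i+j}(x) with coefficients reduced modulo p. Then det 𝔹_p^{(m)}(x) = x^{pm} · det 𝔹_p^{(0)}(x) in (ℤ/pℤ)[x]. -/
theorem stirling2_eq_stirlingSecond : ∀ n j : ℕ, stirling2 n j = Nat.stirlingSecond n j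
  | 0, 0 => rfl
  | 0, _ + 1 => rfl
  | _ + 1, 0 => rfl
  | n + 1, j + 1 => by
    rw [stirling2, Nat.stirlingSecond_succ_succ, stirling2_eq_stirlingSecond n (j + 1),
      stirling2_eq_stirlingSecond n j]

theorem stirling2_eq_zero_of_lt_s19 {n j : ℕ} (h : n < j) : stirling2 n j = 0 := by
  rw [stirling2_eq_stirlingSecond, Nat.stirlingSecond_eq_zero_of_lt h]

section BellOperator

open Polynomial

variable (R : Type*) [CommRing R]

/-- The operator `f ↦ x (f + f')` on `R[x]`, which sends `b_n(x)` to `b_{n+1}(x)`. -/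
noncomputable def bellOperator : Module.End R R[X] :=
  LinearMap.mulLeft R X * (1 + derivative)

theorem bellOperator_apply (f : R[X]) : bellOperator R f = X * (f + derivative f) := rfl

theorem bellEval_X_succ (n : ℕ) :
    bellEval (n + 1) (X : R[X]) = bellOperator R (bellEval n X) := by
  have hterm (j : ℕ) : bellOperator R ((stirling2 n j : R[X]) * X ^ j) =
      (stirling2 n j : R[X]) * ((j : R[X]) * X ^ j + X ^ (j + 1)) := by
    cases j <;> simp [bellOperator_apply] <;> ring
  have htop : stirling2 n (n + 1) = 0 := stirling2_eq_zero_of_lt_s19 n.lt_succ_self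
  have hshift : ∑ j ∈ Finset.range (n + 1), (stirling2 n j : R[X]) * ((j : R[X]) * X ^ j) =
      ∑ j ∈ Finset.range (n + 1),
        (stirling2 n (j + 1) : R[X]) * (((j + 1 : ℕ) : R[X]) * X ^ (j + 1)) := by
    have h := Finset.sum_range_succ'
      (fun j => (stirling2 n j : R[X]) * ((j : R[X]) * X ^ j)) (n + 1)
    rw [Finset.sum_range_succ] at h
    simpa [htop] using h
  simp only [bellEval, map_sum, hterm, mul_add, Finset.sum_add_distrib]
  rw [hshift, Finset.sum_range_succ', ← Finset.sum_add_distrib]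
  simp only [stirling2, Nat.cast_zero, zero_mul, add_zero]
  refine Finset.sum_congr rfl fun j _ => ?_
  push_cast
  ring

theorem bellEval_X_add (n k : ℕ) :
    bellEval (n + k) (X : R[X]) = (bellOperator R ^ k) (bellEval n X) := by
  induction k with
  | zero => rfl
  | succ k ih => rw [← add_assoc, bellEval_X_succ, ih, pow_succ', Module.End.mul_apply]

theorem bellOperator_X_pow_mul (k : ℕ) (f : R[X]) :
    bellOperator R (X ^ k * f) = (k : R[X]) * (X ^ k * f) + X ^ (k + 1) * (f + derivative f) := by
  cases k
  · simp [bellOperator_apply]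
  · simp [bellOperator_apply]
    ring

/-- The falling factorial `T (T - 1) ⋯ (T - k + 1)` of the Bell operator `T` is
`x ^ k (1 + d/dx) ^ k`. -/
theorem aeval_bellOperator_descPochhammer (k : ℕ) (f : R[X]) :
    aeval (bellOperator R) (descPochhammer R k) f =
      X ^ k * ((1 + derivative : Module.End R R[X]) ^ k) f := by
  induction k with
  | zero => simp
  | succ k ih =>
    rw [descPochhammer_succ_right, mul_comm, map_mul, Module.End.mul_apply, 
      pow_succ' (1 + derivative : Module.End R R[X]), Module.End.mul_apply, ih, map_sub, aeval_X, map_natCast, LinearMap.sub_apply,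
      bellOperator_X_pow_mul, Module.End.natCast_apply, nsmul_eq_mul, add_sub_cancel_left]
    rfl

end BellOperator

section Touchard

open Polynomial

variable (p : ℕ) [Fact p.Prime]

theorem descPochhammer_zmod_self : descPochhammer (ZMod p) p = X ^ p - X := by
  have hp : p.Prime := Fact.out
  have hmonic : (X ^ p - X : (ZMod p)[X]).Monic :=
    monic_X_pow_sub (by simpa using hp.one_lt)
  have hdeg : (X ^ p - X : (ZMod p)[X]).natDegree = p :=
    FiniteField.X_pow_card_sub_X_natDegree_eq _ hp.one_lt
  refine eq_of_degree_sub_lt_of_eval_finset_eq Finset.univ ?_ fun a _ => ?_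
  · rw [Finset.card_univ, ZMod.card]
    have hlt := degree_sub_lt_left (p := descPochhammer (ZMod p) p) (q := X ^ p - X)
      (by rw [degree_eq_natDegree (monic_descPochhammer _ p).ne_zero,
        degree_eq_natDegree hmonic.ne_zero, hdeg, descPochhammer_natDegree])
      (monic_descPochhammer _ p).ne_zero
      (by rw [(monic_descPochhammer _ p).leadingCoeff, hmonic.leadingCoeff])
    rwa [degree_eq_natDegree (monic_descPochhammer _ p).ne_zero,
      descPochhammer_natDegree] at hlt
  · rw [← ZMod.natCast_zmod_val a, descPochhammer_eval_eq_descFactorial,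
      Nat.descFactorial_of_lt (ZMod.val_lt a)]
    simp

theorem iterate_derivative_char_eq_zero (f : (ZMod p)[X]) : derivative^[p] f = 0 := by
  rw [← factorial_smul_hasseDeriv, LinearMap.smul_apply, ← Nat.cast_smul_eq_nsmul (ZMod p),
    (ZMod.natCast_eq_zero_iff _ _).2 (Nat.dvd_factorial (Fact.out : p.Prime).pos le_rfl), zero_smul]

theorem one_add_derivative_pow_char :
    (1 + derivative : Module.End (ZMod p) (ZMod p)[X]) ^ p = 1 := by
  have : CharP (Module.End (ZMod p) (ZMod p)[X]) p :=
    (CharP.charP_iff_prime_eq_zero Fact.out).2 <| by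
      refine LinearMap.ext fun f => ?_
      simp [Module.End.natCast_apply]
  rw [add_pow_char_of_commute p (Commute.one_left _), one_pow, add_eq_left]
  refine LinearMap.ext fun f => ?_
  rw [Module.End.pow_apply, LinearMap.zero_apply]
  exact iterate_derivative_char_eq_zero p f

/-- Touchard's congruence for Bell polynomials. -/
theorem bellEval_add_prime (n : ℕ) :
    bellEval (n + p) (X : (ZMod p)[X]) = X ^ p * bellEval n X + bellEval (n + 1) X := by
  have h := aeval_bellOperator_descPochhammer (ZMod p) p (bellEval n X)
  rw [descPochhammer_zmod_self, one_add_derivative_pow_char, Module.End.one_apply, map_sub,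
    map_pow, aeval_X, LinearMap.sub_apply, ← bellEval_X_add, ← bellEval_X_succ] at h
  exact sub_eq_iff_eq_add.1 h

end Touchard

/-- If `u (n + q + 1) = c u n + u (n + 1)` with `q > 0` even, shifting the Hankel matrix of order
`q + 1` by one step multiplies its determinant by `c`. -/
theorem det_hankel_succ_of_recurrence {R : Type*} [CommRing R] {q : ℕ} (hq : 0 < q)
    (hqe : Even q) (u : ℕ → R) (c : R) (hu : ∀ n, u (n + (q + 1)) = c * u n + u (n + 1))
    (m : ℕ) :
    (Matrix.of fun i j : Fin (q + 1) => u (m + 1 + i + j)).det =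
      c * (Matrix.of fun i j : Fin (q + 1) => u (m + i + j)).det := by
  set B := Matrix.of fun i j : Fin (q + 1) => u (m + i + j)
  set N := B.submatrix (finRotate (q + 1)) id
  have hne : (0 : Fin (q + 1)) ≠ Fin.last q := (Fin.pos_iff_ne_zero.1 (by simpa [Fin.lt_def])).symm
  have hN : N.det = B.det := by
    simp [N, Matrix.det_permute, sign_finRotate, hqe.neg_one_pow]
  have hrow (i : Fin (q + 1)) (hi : i ≠ Fin.last q) (j : Fin (q + 1)) :
      N i j = u (m + 1 + i + j) := by
    have : ((finRotate (q + 1) i : Fin (q + 1)) : ℕ) = i + 1 := coe_finRotate_of_ne_last hi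
    simp only [N, B, Matrix.submatrix_apply, Matrix.of_apply, id, this]
    congr 1
    ring
  have hlast (j : Fin (q + 1)) : N (Fin.last q) j = u (m + j) := by
    simp [N, B]
  have hshift : (Matrix.of fun i j : Fin (q + 1) => u (m + 1 + i + j)) =
      N.updateRow (Fin.last q) (c • N (Fin.last q) + N 0) := by
    ext i j
    by_cases hi : i = Fin.last q
    · subst hi
      rw [Matrix.updateRow_self, Pi.add_apply, Pi.smul_apply, hlast, hrow 0 hne, smul_eq_mul,
        Matrix.of_apply]
      convert hu (m + j) using 2
      · simp only [Fin.val_last]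
        ring
      · simp [add_right_comm]
    · rw [Matrix.updateRow_ne hi, hrow i hi, Matrix.of_apply]
  rw [hshift, Matrix.det_updateRow_add, Matrix.det_updateRow_smul, Matrix.updateRow_eq_self, hN,
    Matrix.det_updateRow_eq_zero hne, add_zero]

/-- Shifted Hankel determinants of Bell polynomials modulo `p`:
`det (b_{m+i+j}(x))_{0 ≤ i,j ≤ p-1} = x^{pm} det (b_{i+j}(x))_{0 ≤ i,j ≤ p-1}`
in `(ℤ/pℤ)[x]`. -/
theorem bell_hankel_determinant_shift (p : ℕ) [Fact p.Prime] (hodd : p ≠ 2) (m : ℕ) :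
    Matrix.det (Matrix.of fun i j : Fin p =>
        bellEval (m + (i : ℕ) + (j : ℕ)) (Polynomial.X : Polynomial (ZMod p))) =
      (Polynomial.X : Polynomial (ZMod p)) ^ (p * m) *
        Matrix.det (Matrix.of fun i j : Fin p =>
          bellEval ((i : ℕ) + (j : ℕ)) (Polynomial.X : Polynomial (ZMod p))) := by
  have hp : p.Prime := Fact.out
  obtain ⟨q, rfl⟩ := Nat.exists_eq_add_one_of_ne_zero hp.ne_zero
  have hqe : Even q := by
    simpa [Nat.even_add_one, parity_simps] using hp.odd_of_ne_two hodd
  have hq : 0 < q := Nat.succ_lt_succ_iff.1 hp.one_lt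
  induction m with
  | zero => simp
  | succ m ih =>
    rw [det_hankel_succ_of_recurrence hq hqe (fun n => bellEval n Polynomial.X) _
      (bellEval_add_prime (q + 1)) m, ih, Nat.mul_succ, pow_add]
    ring
end
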